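/- Let N ≥ 1 and G = Equiv.Perm (Fin N). Fix orders D_in, D_out ∈ ℕ and D ≥ N, and let I = (Fin D_in → Fin N), H = (Fin D → Fin N), O = (Fin D_out → Fin N), each carrying the diagonal G-action. Consider single-hidden-layer G-equivariant networks ψ̂(x)(o) = Σ_{c=1}^{C} Σ_{h ∈ H} Φ'_c(o, h) · ReLU( (Σ_{i ∈ I} Φ_c(h, i) · x(i)) + b_c ) whose weights satisfy Φ_c(σ • h, σ • i) = Φ_c(h, i) and Φ'_c(σ • o, σ • h) = Φ'_c(o, h) for all σ ∈ G. Then for every continuous G-equivariant ψ : (I → ℝ) → (O → ℝ), every compact K ⊆ (I → ℝ), and every ε > 0, there exist C, weights Φ_c, Φ'_c satisfying the constraints, and biases b_c ∈ ℝ such that max_{o ∈ O} |ψ(x)(o) − ψ̂(x)(o)| ≤ ε for all x ∈ K. -/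

import Mathlib

/-- The piecewise linear interpolation of `f` at the nodes `a + k * δ`, `k ≤ n`, as a sum of
ReLU ramps. -/
noncomputable def reluInterpolation (f : ℝ → ℝ) (a δ : ℝ) (n : ℕ) (t : ℝ) : ℝ :=
  f a + ∑ k ∈ Finset.range n, (f (a + (k + 1) * δ) - f (a + k * δ)) / δ *
    (max 0 (t - (a + k * δ)) - max 0 (t - (a + (k + 1) * δ)))

theorem reluInterpolation_succ (f : ℝ → ℝ) (a δ : ℝ) (n : ℕ) (t : ℝ) :
    reluInterpolation f a δ (n + 1) t = reluInterpolation f a δ n t +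
      (f (a + (n + 1) * δ) - f (a + n * δ)) / δ *
        (max 0 (t - (a + n * δ)) - max 0 (t - (a + (n + 1) * δ))) := by
  simp only [reluInterpolation, Finset.sum_range_succ, add_assoc]

theorem reluInterpolation_of_le (f : ℝ → ℝ) {a δ : ℝ} (hδ : 0 < δ) (n : ℕ) {t : ℝ}
    (ht : a + n * δ ≤ t) : reluInterpolation f a δ n t = f (a + n * δ) := by
  induction n with
  | zero => simp [reluInterpolation]
  | succ n ih =>
    push_cast at ht ⊢
    rw [reluInterpolation_succ, ih (by nlinarith), max_eq_right (by nlinarith),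
      max_eq_right (by linarith)]
    field_simp
    ring

theorem abs_sub_reluInterpolation_le {f : ℝ → ℝ} {a δ η : ℝ} (hδ : 0 < δ) (n : ℕ)
    (hη : 0 ≤ η)
    (hf : ∀ s ∈ Set.Icc a (a + n * δ), ∀ t ∈ Set.Icc a (a + n * δ),
      |s - t| ≤ δ → |f s - f t| ≤ η) {t : ℝ} (ht : t ∈ Set.Icc a (a + n * δ)) :
    |f t - reluInterpolation f a δ n t| ≤ η := by
  induction n with
  | zero =>
    obtain rfl : t = a := le_antisymm (by simpa using ht.2) ht.1
    simpa [reluInterpolation] using hη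
  | succ n ih =>
    have hn : (0 : ℝ) ≤ n * δ := by positivity
    push_cast at hf ht
    have hle : a + n * δ ≤ a + (n + 1) * δ := by nlinarith
    rw [reluInterpolation_succ]
    rcases le_total t (a + n * δ) with h | h
    · rw [max_eq_left (by linarith), max_eq_left (by linarith), sub_self, mul_zero, add_zero]
      exact ih (fun s hs u hu => hf s ⟨hs.1, hs.2.trans hle⟩ u ⟨hu.1, hu.2.trans hle⟩) ⟨ht.1, h⟩
    · rw [reluInterpolation_of_le f hδ n h, max_eq_right (by linarith),
        max_eq_left (by linarith [ht.2])]
      have hl := abs_le.1 (hf t ht (a + n * δ) ⟨by linarith, hle⟩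
        (abs_le.2 ⟨by linarith, by linarith [ht.2]⟩))
      have hr := abs_le.1 (hf t ht (a + (n + 1) * δ) ⟨by linarith, le_rfl⟩
        (abs_le.2 ⟨by linarith, by linarith [ht.2]⟩))
      obtain ⟨θ, hθ⟩ : ∃ θ, θ = (t - (a + n * δ)) / δ := ⟨_, rfl⟩
      have h0 : 0 ≤ θ := hθ ▸ div_nonneg (by linarith) hδ.le
      have h1 : θ ≤ 1 := by
        rw [hθ, div_le_one hδ]
        linarith [ht.2]
      have key : f t - (f (a + n * δ) + (f (a + (n + 1) * δ) - f (a + n * δ)) / δ *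
          (t - (a + n * δ) - 0)) =
          (1 - θ) * (f t - f (a + n * δ)) + θ * (f t - f (a + (n + 1) * δ)) := by
        rw [hθ]
        ring
      rw [key, abs_le]
      constructor <;> nlinarith

/-- The ridge function `x ↦ ReLU (⟨p.1, x⟩ + p.2)` restricted to `K`. -/
def reluNeuron {ι : Type*} [Fintype ι] (K : Set (ι → ℝ)) (p : (ι → ℝ) × ℝ) : C(K, ℝ) where
  toFun x := max 0 (∑ i, p.1 i * x.1 i + p.2)
  continuous_toFun := (show Continuous fun x : ι → ℝ => max 0 (∑ i, p.1 i * x i + p.2) by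
    fun_prop).comp continuous_subtype_val

/-- The exponential ridge functions on `K`, as a monoid homomorphism in the weights. -/
noncomputable def expRidge {ι : Type*} [Fintype ι] (K : Set (ι → ℝ)) :
    Multiplicative (ι → ℝ) →* C(K, ℝ) where
  toFun w := ⟨fun x => Real.exp (∑ i, w.toAdd i * x.1 i),
    (show Continuous fun x : ι → ℝ => Real.exp (∑ i, w.toAdd i * x i) by
      fun_prop).comp continuous_subtype_val⟩
  map_one' := by
    ext x
    simp
  map_mul' v w := by
    ext x
    simp [add_mul, Finset.sum_add_distrib, Real.exp_add]

theorem ridge_mem_closure_span_reluNeuron {ι : Type*} [Fintype ι] {K : Set (ι → ℝ)}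
    (hK : IsCompact K) {f : ℝ → ℝ} (hf : Continuous f) (w : ι → ℝ) (g : C(K, ℝ))
    (hg : ∀ x, g x = f (∑ i, w i * x.1 i)) :
    g ∈ closure (Submodule.span ℝ (Set.range (reluNeuron K)) : Set C(K, ℝ)) := by
  have : CompactSpace K := isCompact_iff_compactSpace.1 hK
  rw [Metric.mem_closure_iff]
  intro ε hε
  obtain ⟨R, hR⟩ := hK.exists_bound_of_continuousOn (f := fun x : ι → ℝ => ∑ i, w i * x i)
    (by fun_prop)
  obtain ⟨S, hS, hRS⟩ : ∃ S : ℝ, 0 < S ∧ R ≤ S := ⟨max R 1, by positivity, le_max_left _ _⟩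
  obtain ⟨δ, hδ, hfδ⟩ := Metric.uniformContinuousOn_iff.1
    ((isCompact_Icc (a := -S) (b := S)).uniformContinuousOn_of_continuous hf.continuousOn)
    (ε / 2) (by positivity)
  obtain ⟨n, hn⟩ := exists_nat_gt (2 * S / δ)
  have hn0 : (0 : ℝ) < n := lt_of_le_of_lt (by positivity) hn
  obtain ⟨d, hd⟩ : ∃ d : ℝ, d = 2 * S / n := ⟨_, rfl⟩
  have hd0 : 0 < d := hd ▸ by positivity
  have hnd : -S + n * d = S := by
    rw [hd]
    field_simp
    ring
  have hdδ : d < δ := by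
    rw [hd, div_lt_iff₀ hn0, mul_comm δ]
    exact (div_lt_iff₀ hδ).1 hn
  have hmem : ∀ p, reluNeuron K p ∈ Submodule.span ℝ (Set.range (reluNeuron K)) :=
    fun p => Submodule.subset_span ⟨p, rfl⟩
  refine ⟨f (-S) • reluNeuron K (0, 1) + ∑ k ∈ Finset.range n,
    ((f (-S + (k + 1) * d) - f (-S + k * d)) / d) •
      (reluNeuron K (w, -(-S + k * d)) - reluNeuron K (w, -(-S + (k + 1) * d))), ?_, ?_⟩
  · exact add_mem (Submodule.smul_mem _ _ (hmem _)) (sum_mem fun k _ =>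
      Submodule.smul_mem _ _ (sub_mem (hmem _) (hmem _)))
  · refine lt_of_le_of_lt ((ContinuousMap.dist_le (half_pos hε).le).2 fun x => ?_)
      (half_lt_self hε)
    have hx := abs_le.1 (hR x.1 x.2)
    have happ := abs_sub_reluInterpolation_le (f := f) (a := -S) hd0 n (half_pos hε).le
      (fun s hs t ht hst => by
        rw [hnd] at hs ht
        exact (hfδ s hs t ht (hst.trans_lt hdδ)).le)
      (t := ∑ i, w i * x.1 i) (by rw [hnd]; constructor <;> linarith)
    rw [Real.dist_eq, hg]
    convert happ using 3
    simp [reluNeuron, reluInterpolation, ContinuousMap.sum_apply, sub_eq_add_neg, mul_add]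

theorem topologicalClosure_adjoin_expRidge {ι : Type*} [Fintype ι] (K : Set (ι → ℝ))
    [CompactSpace K] :
    (Algebra.adjoin ℝ (Set.range (expRidge K))).topologicalClosure = ⊤ := by
  classical
  apply ContinuousMap.subalgebra_topologicalClosure_eq_top_of_separatesPoints
  intro x y hxy
  obtain ⟨i, hi⟩ := Function.ne_iff.1 (Subtype.coe_ne_coe.2 hxy)
  refine ⟨_, ⟨expRidge K (Multiplicative.ofAdd (Pi.single i 1)),
    Algebra.subset_adjoin ⟨_, rfl⟩, rfl⟩, ?_⟩
  simpa [expRidge, Pi.single_apply] using hi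

theorem closure_span_reluNeuron {ι : Type*} [Fintype ι] {K : Set (ι → ℝ)} (hK : IsCompact K) :
    closure (Submodule.span ℝ (Set.range (reluNeuron K)) : Set C(K, ℝ)) = Set.univ := by
  have : CompactSpace K := isCompact_iff_compactSpace.1 hK
  have hle : Subalgebra.toSubmodule (Algebra.adjoin ℝ (Set.range (expRidge K))) ≤
      (Submodule.span ℝ (Set.range (reluNeuron K))).topologicalClosure := by
    rw [Algebra.adjoin_eq_span, ← MonoidHom.coe_mrange, Submonoid.closure_eq, Submodule.span_le]
    rintro _ ⟨w, rfl⟩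
    exact ridge_mem_closure_span_reluNeuron hK Real.continuous_exp w.toAdd _ fun _ => rfl
  have hsub : closure (Algebra.adjoin ℝ (Set.range (expRidge K)) : Set C(K, ℝ)) ⊆
      closure (Submodule.span ℝ (Set.range (reluNeuron K)) : Set C(K, ℝ)) :=
    closure_minimal hle isClosed_closure
  refine Set.eq_univ_of_univ_subset (subset_trans ?_ hsub)
  rw [← Subalgebra.topologicalClosure_coe, topologicalClosure_adjoin_expRidge K]
  exact Set.subset_univ _

/-- **Universal approximation** by ReLU networks with one hidden layer, on compact sets. -/
theorem exists_relu_network_approx {ι κ : Type*} [Fintype ι] [Fintype κ] {K : Set (ι → ℝ)}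
    (hK : IsCompact K) {ψ : (ι → ℝ) → κ → ℝ} (hψ : Continuous ψ) {ε : ℝ} (hε : 0 < ε) :
    ∃ (C : ℕ) (w : Fin C → ι → ℝ) (a : Fin C → κ → ℝ) (b : Fin C → ℝ),
      ∀ x ∈ K, ∀ o, |ψ x o - ∑ c, a c o * max 0 (∑ i, w c i * x i + b c)| ≤ ε := by
  classical
  have : CompactSpace K := isCompact_iff_compactSpace.1 hK
  have happ (o : κ) : ∃ l : (ι → ℝ) × ℝ →₀ ℝ,
      ∀ x ∈ K, |ψ x o - l.sum fun p r => r * max 0 (∑ i, p.1 i * x i + p.2)| ≤ ε := by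
    let g : C(K, ℝ) := ⟨fun x => ψ x.1 o, by fun_prop⟩
    obtain ⟨_, hmem, hlt⟩ := Metric.mem_closure_iff.1
      ((closure_span_reluNeuron hK).symm ▸ Set.mem_univ g) ε hε
    obtain ⟨l, rfl⟩ := Finsupp.mem_span_range_iff_exists_finsupp.1 hmem
    refine ⟨l, fun x hx => ?_⟩
    have := (ContinuousMap.dist_le hε.le).1 hlt.le ⟨x, hx⟩
    rw [Real.dist_eq] at this
    simpa [g, reluNeuron, Finsupp.sum, ContinuousMap.sum_apply] using this
  choose l hl using happ
  let T := Finset.univ.biUnion fun o => (l o).support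
  refine ⟨T.card, fun c => (T.equivFin.symm c).1.1, fun c o => l o (T.equivFin.symm c),
    fun c => (T.equivFin.symm c).1.2, fun x hx o => ?_⟩
  convert hl o x hx using 2
  congr 1
  rw [Finsupp.sum_of_support_subset (l o)
    (Finset.subset_biUnion_of_mem (fun o => (l o).support) (Finset.mem_univ o)) _ (by simp),
    ← Finset.sum_coe_sort T]
  exact Equiv.sum_comp T.equivFin.symm
    fun p : T => l o p * max 0 (∑ i, p.1.1 i * x i + p.1.2)

/-- The kernel on `H × J` supported on the orbit of `s` in the first variable and invariant under
the diagonal action, whose value at `(σ • s, j)` is `u (σ⁻¹ • j)`. -/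
noncomputable def orbitKernel {N D E : ℕ} (s : Fin D → Fin N) (u : (Fin E → Fin N) → ℝ)
    (h : Fin D → Fin N) (j : Fin E → Fin N) : ℝ :=
  ∑ σ : Equiv.Perm (Fin N), if h = (fun d => σ (s d)) then u (fun d => σ⁻¹ (j d)) else 0

theorem orbitKernel_smul_smul {N D E : ℕ} (s : Fin D → Fin N) (u : (Fin E → Fin N) → ℝ)
    (σ : Equiv.Perm (Fin N)) (h : Fin D → Fin N) (j : Fin E → Fin N) :
    orbitKernel s u (fun d => σ (h d)) (fun d => σ (j d)) = orbitKernel s u h j := by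
  unfold orbitKernel
  rw [← Equiv.sum_comp (Equiv.mulLeft σ)]
  refine Finset.sum_congr rfl fun τ _ => ?_
  simp [funext_iff, Equiv.Perm.mul_apply]

theorem perm_comp_injective_of_surjective {N D : ℕ} {s : Fin D → Fin N} (hs : Function.Surjective s) :
    Function.Injective fun (σ : Equiv.Perm (Fin N)) d => σ (s d) := by
  intro σ τ h
  ext y
  obtain ⟨d, rfl⟩ := hs y
  exact congrArg Fin.val (congrFun h d)

theorem orbitKernel_smul_left {N D E : ℕ} {s : Fin D → Fin N} (hs : Function.Surjective s)
    (u : (Fin E → Fin N) → ℝ) (σ : Equiv.Perm (Fin N)) (j : Fin E → Fin N) :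
    orbitKernel s u (fun d => σ (s d)) j = u fun d => σ⁻¹ (j d) := by
  have hinj (τ : Equiv.Perm (Fin N)) :
      ((fun d => σ (s d)) = fun d => τ (s d)) ↔ σ = τ := (perm_comp_injective_of_surjective hs).eq_iff
  simp [orbitKernel, hinj]

theorem sum_orbitKernel_mul {N D E : ℕ} (s : Fin D → Fin N)
    (u : (Fin E → Fin N) → ℝ) (j : Fin E → Fin N) (F : (Fin D → Fin N) → ℝ) :
    ∑ h, orbitKernel s u h j * F h =
      ∑ σ : Equiv.Perm (Fin N), u (fun d => σ⁻¹ (j d)) * F fun d => σ (s d) := by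
  simp only [orbitKernel, Finset.sum_mul]
  rw [Finset.sum_comm]
  simp [ite_mul]

theorem sum_comp_perm_inv_mul {N E : ℕ} (u x : (Fin E → Fin N) → ℝ) (σ : Equiv.Perm (Fin N)) :
    ∑ i, u (fun d => σ⁻¹ (i d)) * x i = ∑ i, u i * x fun d => σ (i d) := by
  rw [← Equiv.sum_comp (Equiv.piCongrRight fun _ : Fin E => σ)]
  simp only [Equiv.piCongrRight_apply, Pi.map_apply, Equiv.Perm.coe_inv, Equiv.symm_apply_apply]
  rfl


/-- **Universality of equivariant hyper-graph networks.**
Let `G = Equiv.Perm (Fin N)` act diagonally on tensor index sets `I = Fin Din → Fin N`,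
`H = Fin D → Fin N`, `O = Fin Dout → Fin N`, with `D ≥ N`.  Single-hidden-layer
`G`-equivariant networks with hidden layer of order `D` and parameter-sharing constraints
`Φ c (σ • h) (σ • i) = Φ c h i`, `Φ' c (σ • o) (σ • h) = Φ' c o h` can approximate any
continuous `G`-equivariant function uniformly on compact sets, for arbitrary input and
output orders `Din`, `Dout`. -/
theorem hypergraph_network_universality
    (N : ℕ) (hN : 1 ≤ N) (Din Dout D : ℕ) (hD : N ≤ D)
    (ψ : ((Fin Din → Fin N) → ℝ) → ((Fin Dout → Fin N) → ℝ))
    (hcont : Continuous ψ)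
    (hequiv : ∀ (σ : Equiv.Perm (Fin N)) (x : (Fin Din → Fin N) → ℝ),
      ψ (fun i => x (fun d => σ⁻¹ (i d))) = fun o => ψ x (fun d => σ⁻¹ (o d)))
    (K : Set ((Fin Din → Fin N) → ℝ)) (hK : IsCompact K) (ε : ℝ) (hε : 0 < ε) :
    ∃ (C : ℕ) (Φ : Fin C → (Fin D → Fin N) → (Fin Din → Fin N) → ℝ)
      (Φ' : Fin C → (Fin Dout → Fin N) → (Fin D → Fin N) → ℝ) (b : Fin C → ℝ),
      (∀ (c : Fin C) (σ : Equiv.Perm (Fin N)) (h : Fin D → Fin N) (i : Fin Din → Fin N),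
        Φ c (fun d => σ (h d)) (fun d => σ (i d)) = Φ c h i) ∧
      (∀ (c : Fin C) (σ : Equiv.Perm (Fin N)) (o : Fin Dout → Fin N) (h : Fin D → Fin N),
        Φ' c (fun d => σ (o d)) (fun d => σ (h d)) = Φ' c o h) ∧
      ∀ x ∈ K, ∀ o : Fin Dout → Fin N,
        |ψ x o - ∑ c : Fin C, ∑ h : Fin D → Fin N,
            Φ' c o h * max 0 ((∑ i : Fin Din → Fin N, Φ c h i * x i) + b c)| ≤ ε := by
  have hne : Nonempty (Fin N) := ⟨⟨0, hN⟩⟩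
  obtain ⟨s, hs⟩ : ∃ s : Fin D → Fin N, Function.Surjective s :=
    ⟨_, Function.invFun_surjective (Fin.castLE_injective hD)⟩
  let act (σ : Equiv.Perm (Fin N)) (x : (Fin Din → Fin N) → ℝ) : (Fin Din → Fin N) → ℝ :=
    fun i => x fun d => σ (i d)
  obtain ⟨C, w, a, b, happ⟩ := exists_relu_network_approx
    (isCompact_iUnion fun σ => hK.image (f := act σ) (by fun_prop)) hcont hε
  let G : ℝ := Fintype.card (Equiv.Perm (Fin N))
  have hG : 0 < G := Nat.cast_pos.2 Fintype.card_pos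
  refine ⟨C, fun c => orbitKernel s (w c), fun c o h => orbitKernel s (a c) h o / G, b,
    fun c σ h i => orbitKernel_smul_smul s (w c) σ h i,
    fun c σ o h => by simp only [orbitKernel_smul_smul], fun x hx o => ?_⟩
  let net (σ : Equiv.Perm (Fin N)) : ℝ :=
    ∑ c, a c (fun d => σ⁻¹ (o d)) * max 0 (∑ i, w c i * act σ x i + b c)
  have hnet : ∑ c, ∑ h : Fin D → Fin N, orbitKernel s (a c) h o / G *
      max 0 (∑ i, orbitKernel s (w c) h i * x i + b c) = (∑ σ, net σ) / G := by
    simp only [div_mul_eq_mul_div, ← Finset.sum_div, net, act]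
    rw [Finset.sum_comm (γ := Equiv.Perm (Fin N))]
    refine congrArg (· / G) (Finset.sum_congr rfl fun c _ => ?_)
    simp only [sum_orbitKernel_mul, orbitKernel_smul_left hs, sum_comp_perm_inv_mul]
  have hψ (σ : Equiv.Perm (Fin N)) : |ψ x o - net σ| ≤ ε := by
    have hx' := congrFun (hequiv σ⁻¹ x) fun d => σ⁻¹ (o d)
    simp only [inv_inv, Equiv.Perm.coe_inv, Equiv.apply_symm_apply] at hx'
    rw [← hx']
    exact happ (act σ x) (Set.mem_iUnion.2 ⟨σ, x, hx, rfl⟩) _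
  have havg : ψ x o - (∑ σ, net σ) / G = (∑ σ, (ψ x o - net σ)) / G := by
    rw [Finset.sum_sub_distrib, Finset.sum_const, Finset.card_univ, nsmul_eq_mul, sub_div,
      mul_div_cancel_left₀ _ hG.ne']
  rw [hnet, havg, abs_div, abs_of_pos hG, div_le_iff₀ hG, mul_comm]
  calc |∑ σ, (ψ x o - net σ)| ≤ ∑ σ, |ψ x o - net σ| := Finset.abs_sum_le_sum_abs _ _
    _ ≤ ∑ _σ : Equiv.Perm (Fin N), ε := Finset.sum_le_sum fun σ _ => hψ σ
    _ = G * ε := by rw [Finset.sum_const, Finset.card_univ, nsmul_eq_mul]
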